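/- In the C*-setting, suppose in addition that the joint law τ of a is faithful on ℂ⟨X⟩ (τ(f⋆f) = 0 implies f = 0), and let (P_w)_{w∈⟨X⟩_d} be a family of orthonormal polynomials of τ at degree d. Then for every k ≥ 1 and every tuple A of hermitian k×k complex matrices: ‖κ_{τ,d}(A,A)(I_k)‖ ≥ Φ^∞_{a,d}(A) and tr_k(κ_{τ,d}(A,A)(I_k)) ≥ Φ²_{a,d}(A). -/

import Mathlib

open scoped ComplexOrder Matrix

namespace NCCD

/-- Words in the letters `X_1, …, X_n`, i.e. elements of the free monoid on `n` generators. -/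
abbrev Word (n : ℕ) : Type := FreeMonoid (Fin n)

/-- The free unital `*`-algebra `ℂ⟨X_1, …, X_n⟩`, modeled as the monoid algebra of the
free monoid on `n` generators. -/
abbrev NCPoly (n : ℕ) : Type := MonoidAlgebra ℂ (Word n)

/-- The monomial associated to a word. -/
noncomputable def mono {n : ℕ} (w : Word n) : NCPoly n :=
  MonoidAlgebra.of ℂ (Word n) w

/-- The length of a word. -/
def wlen {n : ℕ} (w : Word n) : ℕ := (FreeMonoid.toList w).length

/-- The involution `⋆` on `ℂ⟨X⟩`: conjugate the coefficients and reverse the words. -/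
noncomputable def ncStar {n : ℕ} (f : NCPoly n) : NCPoly n :=
  MonoidAlgebra.ofCoeff (Finsupp.mapDomain (fun w => FreeMonoid.ofList (FreeMonoid.toList w).reverse)
    (Finsupp.mapRange (starRingEnd ℂ) (map_zero _) f.coeff))

/-- `τ` is a positive functional: `τ(f⋆ f) ≥ 0` for all `f`. -/
def IsPositive {n : ℕ} (τ : NCPoly n →ₗ[ℂ] ℂ) : Prop :=
  ∀ f : NCPoly n, 0 ≤ τ (ncStar f * f)

/-- `τ` is tracial: `τ(fg) = τ(gf)`. -/
def IsTracial {n : ℕ} (τ : NCPoly n →ₗ[ℂ] ℂ) : Prop :=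
  ∀ f g : NCPoly n, τ (f * g) = τ (g * f)

/-- `τ` is faithful: `τ(f⋆ f) = 0` implies `f = 0`. -/
def IsFaithful {n : ℕ} (τ : NCPoly n →ₗ[ℂ] ℂ) : Prop :=
  ∀ f : NCPoly n, τ (ncStar f * f) = 0 → f = 0

/-- The strict graded lexicographic order on words. -/
def glLt {n : ℕ} (v w : Word n) : Prop :=
  wlen v < wlen w ∨
    (wlen v = wlen w ∧ List.Lex (· < ·) (FreeMonoid.toList v) (FreeMonoid.toList w))

/-- The graded lexicographic order on words. -/
def glLe {n : ℕ} (v w : Word n) : Prop := glLt v w ∨ v = w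

/-- Words of length at most `d`. -/
abbrev WordLE (n d : ℕ) : Type := {w : Word n // wlen w ≤ d}

instance {n : ℕ} : DecidableEq (Word n) := fun a b =>
  decidable_of_iff (FreeMonoid.toList a = FreeMonoid.toList b)
    ⟨fun h => FreeMonoid.toList.injective h, fun h => by rw [h]⟩

instance (n d : ℕ) : Finite (WordLE n d) := by
  apply Finite.of_surjective
    (f := fun p : (k : Fin (d+1)) × (Fin k → Fin n) =>
      (⟨FreeMonoid.ofList (List.ofFn p.2), by simp [wlen]; omega⟩ : WordLE n d))
  rintro ⟨w, hw⟩
  refine ⟨⟨⟨wlen w, by omega⟩, fun i => (FreeMonoid.toList w).get ⟨i, i.2⟩⟩, ?_⟩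
  apply Subtype.ext
  simp [wlen, List.ofFn_get]

noncomputable instance (n d : ℕ) : Fintype (WordLE n d) := Fintype.ofFinite _

/-- The span `ℂ⟨X⟩_d` of the monomials of degree at most `d`. -/
noncomputable def degLE (n d : ℕ) : Submodule ℂ (NCPoly n) :=
  Submodule.span ℂ {p : NCPoly n | ∃ w : Word n, wlen w ≤ d ∧ p = mono w}

end NCCD

namespace NCCD

/-- Evaluation `A^w` of a word at a tuple of matrices. -/
noncomputable def wordEvalM {n k : ℕ} (A : Fin n → Matrix (Fin k) (Fin k) ℂ) (w : Word n) :
    Matrix (Fin k) (Fin k) ℂ :=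
  ((FreeMonoid.toList w).map A).prod

/-- Evaluation `f(A)` of a noncommutative polynomial at a tuple of matrices. -/
noncomputable def polyEvalM {n k : ℕ} (A : Fin n → Matrix (Fin k) (Fin k) ℂ) (f : NCPoly n) :
    Matrix (Fin k) (Fin k) ℂ :=
  Finsupp.sum f.coeff fun w c => c • wordEvalM A w

/-- `P(A)(I_k)` for the matrix noncommutative polynomial `P = Σ_i a_i ⊗ q_i`. -/
noncomputable def evalId {n k : ℕ} {ι : Type*} [Fintype ι]
    (A : Fin n → Matrix (Fin k) (Fin k) ℂ) (a : ι → Matrix (Fin k) (Fin k) ℂ)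
    (q : ι → NCPoly n) : Matrix (Fin k) (Fin k) ℂ :=
  ∑ i, a i * polyEvalM A (q i)

/-- `(Id ⊗ τ)(P P⋆)` for the matrix noncommutative polynomial `P = Σ_i a_i ⊗ q_i`. -/
noncomputable def idTensorTau {n k : ℕ} {ι : Type*} [Fintype ι] (τ : NCPoly n →ₗ[ℂ] ℂ)
    (a : ι → Matrix (Fin k) (Fin k) ℂ) (q : ι → NCPoly n) : Matrix (Fin k) (Fin k) ℂ :=
  ∑ i, ∑ j, τ (q i * ncStar (q j)) • (a i * (a j)ᴴ)

/-- The Christoffel–Darboux kernel evaluation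
`κ_{τ,d}(A,A)(I_k) = Σ_w P_w(A) ⬝ (P_w⋆)(A)`. -/
noncomputable def cdKernel {n k : ℕ} (d : ℕ) (P : Word n → NCPoly n)
    (A : Fin n → Matrix (Fin k) (Fin k) ℂ) : Matrix (Fin k) (Fin k) ℂ :=
  ∑ w : WordLE n d, polyEvalM A (P w.1) * polyEvalM A (ncStar (P w.1))

end NCCD

namespace NCCD

/-- A family of orthonormal polynomials of a faithful positive tracial state `τ` at degree `d`:
a family `(P_w)` in `ℂ⟨X⟩_d` with `P_1 = 1`, `τ(P_v⋆ P_w) = δ_{v,w}`, `τ(P_v⋆ w) = 0` whenever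
`w <_gl v`, and `τ(P_w⋆ w) > 0`, for all words `v, w` of length at most `d`. -/
def IsONB {n : ℕ} (τ : NCPoly n →ₗ[ℂ] ℂ) (d : ℕ) (P : Word n → NCPoly n) : Prop :=
  (∀ w : Word n, wlen w ≤ d → P w ∈ degLE n d) ∧
  P 1 = 1 ∧
  (∀ v w : Word n, wlen v ≤ d → wlen w ≤ d →
    τ (ncStar (P v) * P w) = if v = w then 1 else 0) ∧
  (∀ v w : Word n, wlen v ≤ d → wlen w ≤ d → glLt w v → τ (ncStar (P v) * mono w) = 0) ∧
  (∀ w : Word n, wlen w ≤ d → 0 < τ (ncStar (P w) * mono w))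

end NCCD

open scoped Matrix.Norms.L2Operator

namespace NCCD

section CStar

variable {𝒜 : Type*} [NormedRing 𝒜] [StarRing 𝒜] [CStarRing 𝒜] [CompleteSpace 𝒜]
  [NormedAlgebra ℂ 𝒜] [StarModule ℂ 𝒜]

/-- `tr` is a tracial state on the unital C*-algebra `𝒜`: a positive linear functional with
`tr 1 = 1` and `tr (xy) = tr (yx)`. -/
def IsTracialStateA (tr : 𝒜 →ₗ[ℂ] ℂ) : Prop :=
  tr 1 = 1 ∧ (∀ x : 𝒜, 0 ≤ tr (star x * x)) ∧ (∀ x y : 𝒜, tr (x * y) = tr (y * x))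

/-- `tr` is faithful: `tr (x⋆x) = 0` implies `x = 0`. -/
def IsFaithfulA (tr : 𝒜 →ₗ[ℂ] ℂ) : Prop :=
  ∀ x : 𝒜, tr (star x * x) = 0 → x = 0

/-- Evaluation `a^w` of a word at a tuple of elements of `𝒜`. -/
def wordEvalA {N : ℕ} (a : Fin N → 𝒜) (w : Word N) : 𝒜 :=
  ((FreeMonoid.toList w).map a).prod

/-- Evaluation `f(a)` of a scalar noncommutative polynomial at a tuple of elements of `𝒜`. -/
noncomputable def polyEvalA {N : ℕ} (a : Fin N → 𝒜) (f : NCPoly N) : 𝒜 :=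
  Finsupp.sum f.coeff fun w z => z • wordEvalA a w

/-- Evaluation `P(a) = Σ_w c_w ⊗ a^w ∈ M_k(𝒜)` of the matrix noncommutative polynomial with
coefficients `e : ⟨X⟩_d → M_k(ℂ)`. -/
noncomputable def matPolyEvalA {N d k : ℕ} (a : Fin N → 𝒜)
    (e : WordLE N d → Matrix (Fin k) (Fin k) ℂ) : Matrix (Fin k) (Fin k) 𝒜 :=
  ∑ w : WordLE N d, (e w).map (fun z => z • wordEvalA a w.1)

/-- `P(A)(I_k) = Σ_w c_w A^w` for the matrix noncommutative polynomial with coefficients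
`e : ⟨X⟩_d → M_k(ℂ)`. -/
noncomputable def matPolyEvalM {N d k : ℕ} (A : Fin N → Matrix (Fin k) (Fin k) ℂ)
    (e : WordLE N d → Matrix (Fin k) (Fin k) ℂ) : Matrix (Fin k) (Fin k) ℂ :=
  ∑ w : WordLE N d, e w * wordEvalM A w.1

/-- The statement `‖P‖² ≤ c` for `P ∈ M_k(𝒜)`, `𝒜` a unital C*-algebra. It is encoded --
equivalently, since `M_k(𝒜)` is again a unital C*-algebra, in which an element is positive if
and only if it is of the form `Q⋆Q`, and `‖P‖² ≤ c` if and only if `c·1 - P⋆P` is positive --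
by the existence of `Q ∈ M_k(𝒜)` with `c·1 - Pᴴ P = Qᴴ Q`. -/
def cstarNormSqLE {k : ℕ} (P : Matrix (Fin k) (Fin k) 𝒜) (c : ℝ) : Prop :=
  ∃ Q : Matrix (Fin k) (Fin k) 𝒜, (c : ℂ) • (1 : Matrix (Fin k) (Fin k) 𝒜) - Pᴴ * P = Qᴴ * Q

/-- The degree-`d` noncommutative Siciak function `Φ²_{a,d}`:
`Φ²_{a,d}(A) = sup { tr_k(P(A)(I_k)† P(A)(I_k)) : P ∈ M_k(ℂ⟨X⟩_d), ‖P(a)‖ ≤ 1 }`. -/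
noncomputable def Phi2 {N : ℕ} (a : Fin N → 𝒜) (d k : ℕ)
    (A : Fin N → Matrix (Fin k) (Fin k) ℂ) : ℝ :=
  sSup { t : ℝ | ∃ e : WordLE N d → Matrix (Fin k) (Fin k) ℂ,
    cstarNormSqLE (matPolyEvalA a e) 1 ∧
    t = (Matrix.trace ((matPolyEvalM A e)ᴴ * matPolyEvalM A e)).re / k }

/-- The degree-`d` noncommutative Siciak function `Φ^∞_{a,d}`:
`Φ^∞_{a,d}(A) = sup { ‖P(A)(I_k)‖² : P ∈ M_k(ℂ⟨X⟩_d), ‖P(a)‖ ≤ 1 }`, the norm on `M_k(ℂ)`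
being the operator (C*) norm. -/
noncomputable def PhiInf {N : ℕ} (a : Fin N → 𝒜) (d k : ℕ)
    (A : Fin N → Matrix (Fin k) (Fin k) ℂ) : ℝ :=
  sSup { t : ℝ | ∃ e : WordLE N d → Matrix (Fin k) (Fin k) ℂ,
    cstarNormSqLE (matPolyEvalA a e) 1 ∧ t = ‖matPolyEvalM A e‖ ^ 2 }

end CStar

end NCCD

namespace NCCD

lemma ncStar_add {n : ℕ} (f g : NCPoly n) : ncStar (f + g) = ncStar f + ncStar g := by
  unfold ncStar
  rw [MonoidAlgebra.coeff_add, Finsupp.mapRange_add (by simp), Finsupp.mapDomain_add,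
    MonoidAlgebra.ofCoeff_add]

lemma ncStar_single {n : ℕ} (w : Word n) (c : ℂ) : ncStar (MonoidAlgebra.single w c) =
    MonoidAlgebra.single (FreeMonoid.ofList (FreeMonoid.toList w).reverse) (starRingEnd ℂ c) := by
  unfold ncStar
  rw [MonoidAlgebra.coeff_single, Finsupp.mapRange_single, Finsupp.mapDomain_single]
  rfl

lemma ncStar_zero {n : ℕ} : ncStar (0 : NCPoly n) = 0 := by
  simp [ncStar]

lemma ncStar_smul {n : ℕ} (c : ℂ) (f : NCPoly n) :
    ncStar (c • f) = (starRingEnd ℂ c) • ncStar f := by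
  induction f using MonoidAlgebra.induction_linear with
  | zero => simp [ncStar_zero]
  | add f g hf hg => rw [smul_add, ncStar_add, ncStar_add, hf, hg, smul_add]
  | single w r => simp [ncStar_single]

lemma ncStar_mem {n d : ℕ} {f : NCPoly n} (hf : f ∈ degLE n d) : ncStar f ∈ degLE n d := by
  unfold degLE at hf
  induction hf using Submodule.span_induction with
  | mem x h =>
    obtain ⟨w, hw, rfl⟩ := h
    refine Submodule.subset_span ⟨FreeMonoid.ofList (FreeMonoid.toList w).reverse, ?_, ?_⟩
    · simpa [wlen] using hw
    · simp [mono, ncStar_single]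
  | zero => rw [ncStar_zero]; exact Submodule.zero_mem _
  | add x y _ _ hx hy => rw [ncStar_add]; exact Submodule.add_mem _ hx hy
  | smul c x _ hx => rw [ncStar_smul]; exact Submodule.smul_mem _ _ hx

/-- Evaluation as an algebra homomorphism. -/
noncomputable def ev {n : ℕ} {B : Type*} [Ring B] [Algebra ℂ B] (a : Fin n → B) :
    NCPoly n →ₐ[ℂ] B := MonoidAlgebra.lift ℂ B (Word n) (FreeMonoid.lift a)

lemma ev_single {n : ℕ} {B : Type*} [Ring B] [Algebra ℂ B] (a : Fin n → B) (w : Word n) (c : ℂ) :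
    ev a (MonoidAlgebra.single w c) = c • ((FreeMonoid.toList w).map a).prod := by
  simp [ev, FreeMonoid.lift_apply]

lemma polyEvalM_eq {n k : ℕ} (A : Fin n → Matrix (Fin k) (Fin k) ℂ) (f : NCPoly n) :
    polyEvalM A f = ev A f := by
  unfold polyEvalM ev wordEvalM
  rw [MonoidAlgebra.lift_apply]
  simp only [FreeMonoid.lift_apply]

lemma ev_ncStar {n : ℕ} {B : Type*} [Ring B] [Algebra ℂ B] [StarRing B] [StarModule ℂ B]
    (a : Fin n → B) (ha : ∀ i, star (a i) = a i) (f : NCPoly n) :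
    ev a (ncStar f) = star (ev a f) := by
  have key : ∀ l : List (Fin n), star (l.map a).prod = (l.reverse.map a).prod := by
    intro l
    induction l with
    | nil => simp
    | cons x l ih => simp [ih, ha]
  induction f using MonoidAlgebra.induction_linear with
  | zero => simp [ncStar_zero]
  | add f g hf hg => rw [ncStar_add, map_add, map_add, star_add, hf, hg]
  | single w r => rw [ncStar_single, ev_single, ev_single, star_smul, key]; simp

section
variable {𝒜 : Type*} [NormedRing 𝒜] [StarRing 𝒜] [CStarRing 𝒜] [CompleteSpace 𝒜]
  [NormedAlgebra ℂ 𝒜] [StarModule ℂ 𝒜]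

lemma polyEvalA_eq {n : ℕ} (a : Fin n → 𝒜) (f : NCPoly n) :
    polyEvalA a f = ev a f := by
  unfold polyEvalA ev wordEvalA
  rw [MonoidAlgebra.lift_apply]
  simp only [FreeMonoid.lift_apply]

/-- positivity of `id ⊗ tr` applied to `Rᴴ R`. -/
lemma idtr_pos (tr : 𝒜 →ₗ[ℂ] ℂ) (hp : ∀ x : 𝒜, 0 ≤ tr (star x * x)) {k : ℕ}
    (R : Matrix (Fin k) (Fin k) 𝒜) (x : Fin k → ℂ) :
    0 ≤ star x ⬝ᵥ (((Rᴴ * R).map tr) *ᵥ x) := by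
  have : star x ⬝ᵥ (((Rᴴ * R).map tr) *ᵥ x) =
      ∑ l, tr (star (∑ j, x j • R l j) * (∑ j, x j • R l j)) := by
    simp only [dotProduct, Matrix.mulVec, Matrix.map_apply, Matrix.mul_apply,
      Matrix.conjTranspose_apply, star_sum, star_smul, map_sum,
      smul_mul_smul_comm, map_smul, Finset.mul_sum, Finset.sum_mul, smul_eq_mul, Pi.star_apply]
    rw [Finset.sum_comm]
    conv_rhs => rw [Finset.sum_comm]
    refine Finset.sum_congr rfl fun i _ => ?_
    conv_rhs => rw [Finset.sum_comm]
    refine Finset.sum_congr rfl fun j _ => Finset.sum_congr rfl fun l _ => ?_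
    ring
  rw [this]
  exact Finset.sum_nonneg fun l _ => hp _

/-- `(id ⊗ tr)(P P⋆) ≤ 1`. -/
lemma idtr_le (tr : 𝒜 →ₗ[ℂ] ℂ) (htr : IsTracialStateA tr) {k : ℕ}
    (R : Matrix (Fin k) (Fin k) 𝒜) (hR : cstarNormSqLE R 1) :
    ∀ x : Fin k → ℂ, 0 ≤ star x ⬝ᵥ ((1 - (R * Rᴴ).map tr) *ᵥ x) := by
  obtain ⟨Q, hQ⟩ := hR
  simp only [Complex.ofReal_one, one_smul] at hQ
  have h1 : (1 : Matrix (Fin k) (Fin k) 𝒜) - R * Rᴴ =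
      (1 - R * Rᴴ)ᴴ * (1 - R * Rᴴ) + (Q * Rᴴ)ᴴ * (Q * Rᴴ) := by
    have : (Q * Rᴴ)ᴴ * (Q * Rᴴ) = R * (Qᴴ * Q) * Rᴴ := by
      simp [Matrix.conjTranspose_mul, Matrix.mul_assoc]
    rw [this, ← hQ]
    simp only [Matrix.conjTranspose_sub, Matrix.conjTranspose_one, Matrix.conjTranspose_mul,
      Matrix.conjTranspose_conjTranspose]
    noncomm_ring
  have h2 : (1 - (R * Rᴴ).map tr) = ((1 : Matrix (Fin k) (Fin k) 𝒜) - R * Rᴴ).map tr := by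
    ext i j
    simp only [Matrix.sub_apply, Matrix.map_apply, map_sub, Matrix.one_apply]
    split_ifs <;> simp [htr.1]
  have h3 : (1 - (R * Rᴴ).map tr) =
      ((1 - R * Rᴴ)ᴴ * (1 - R * Rᴴ)).map tr + ((Q * Rᴴ)ᴴ * (Q * Rᴴ)).map tr := by
    rw [h2]
    conv_lhs => rw [h1]
    ext i j
    simp
  intro x
  rw [h3, Matrix.add_mulVec, dotProduct_add]
  exact add_nonneg (idtr_pos tr htr.2.1 _ _) (idtr_pos tr htr.2.1 _ _)

lemma expand (tr : 𝒜 →ₗ[ℂ] ℂ) (htr : IsTracialStateA tr)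
    {n : ℕ} (a : Fin n → 𝒜) (ha : ∀ i, IsSelfAdjoint (a i))
    (d : ℕ) (P : Word n → NCPoly n) (hP : ∀ w, wlen w ≤ d → P w ∈ degLE n d)
    (horth : ∀ v w : WordLE n d, tr (star (ev a (P v.1)) * ev a (P w.1)) = if v = w then 1 else 0)
    (w : WordLE n d) :
    ∃ c : WordLE n d → ℂ, ∑ v, c v • ncStar (P v.1) = mono w.1 := by
  set b : WordLE n d → NCPoly n := fun v => ncStar (P v.1) with hb
  have hli : LinearIndependent ℂ b := by
    rw [Fintype.linearIndependent_iff]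
    intro g hg u
    have h := congrArg (fun f => tr (ev a (P u.1) * ev a f)) hg
    simpa [Finset.mul_sum, hb, ev_ncStar a ha, htr.2.2 (ev a (P u.1)), horth] using h
  have hspan : degLE n d = Submodule.span ℂ (Set.range fun w : WordLE n d => mono w.1) := by
    unfold degLE
    congr 1
    ext p
    constructor
    · rintro ⟨w, hw, rfl⟩
      exact ⟨⟨w, hw⟩, rfl⟩
    · rintro ⟨w, rfl⟩
      exact ⟨w.1, w.2, rfl⟩
  have hfd : FiniteDimensional ℂ (degLE n d) := by
    rw [hspan]
    exact FiniteDimensional.span_of_finite ℂ (Set.finite_range _)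
  have hle : Submodule.span ℂ (Set.range b) ≤ degLE n d := by
    rw [Submodule.span_le]
    rintro _ ⟨v, rfl⟩
    exact ncStar_mem (hP _ v.2)
  have heq : Submodule.span ℂ (Set.range b) = degLE n d := by
    refine Submodule.eq_of_le_of_finrank_le hle ?_
    rw [finrank_span_eq_card hli, hspan]
    exact finrank_range_le_card _
  have hm : mono w.1 ∈ Submodule.span ℂ (Set.range b) := by
    rw [heq]
    exact Submodule.subset_span ⟨w.1, w.2, rfl⟩
  exact (Submodule.mem_span_range_iff_exists_fun ℂ).1 hm

/-- `κ - M⋆M` is positive when `M = ∑ b c`, `κ = ∑ c⋆c` and `∑ b b⋆ ≤ 1`. -/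
lemma kernel_bound {k : ℕ} {ι : Type*} [Fintype ι] (b c : ι → Matrix (Fin k) (Fin k) ℂ)
    (hG : (1 - ∑ v, b v * (b v)ᴴ).PosSemidef) :
    (∑ v, (c v)ᴴ * c v - (∑ v, b v * c v)ᴴ * (∑ v, b v * c v)).PosSemidef := by
  set M := ∑ v, b v * c v with hM
  have hM' : Mᴴ = ∑ v, (c v)ᴴ * (b v)ᴴ := by
    rw [hM, Matrix.conjTranspose_sum]
    simp
  have h : ∑ v, (c v)ᴴ * c v - Mᴴ * M =
      ∑ v, (c v - (b v)ᴴ * M)ᴴ * (c v - (b v)ᴴ * M) + Mᴴ * (1 - ∑ v, b v * (b v)ᴴ) * M := by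
    have h1 : ∀ v, (c v - (b v)ᴴ * M)ᴴ * (c v - (b v)ᴴ * M) =
        (c v)ᴴ * c v - ((c v)ᴴ * (b v)ᴴ) * M - Mᴴ * (b v * c v)
          + Mᴴ * (b v * (b v)ᴴ) * M := by
      intro v
      simp only [Matrix.conjTranspose_sub, Matrix.conjTranspose_mul,
        Matrix.conjTranspose_conjTranspose]
      noncomm_ring
    simp only [h1, Finset.sum_add_distrib, Finset.sum_sub_distrib, ← Finset.sum_mul,
      ← Finset.mul_sum, ← hM, ← hM']
    noncomm_ring
  rw [h]
  refine Matrix.PosSemidef.add ?_ (hG.conjTranspose_mul_mul_same M)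
  exact Matrix.posSemidef_sum _ fun v _ => Matrix.posSemidef_conjTranspose_mul_self _

open scoped MatrixOrder in
lemma norm_le_of_psd {k : ℕ} (M K : Matrix (Fin k) (Fin k) ℂ) (h : (K - Mᴴ * M).PosSemidef) :
    ‖M‖ ^ 2 ≤ ‖K‖ := by
  have h1 : ‖M‖ ^ 2 = ‖Mᴴ * M‖ := by
    rw [pow_two, Matrix.l2_opNorm_conjTranspose_mul_self]
  rw [h1]
  refine CStarAlgebra.norm_le_norm_of_nonneg_of_le ?_ ?_
  · exact (Matrix.posSemidef_conjTranspose_mul_self M).nonneg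
  · exact Matrix.le_iff.2 h

/-- The key Loewner inequality. -/
lemma key (tr : 𝒜 →ₗ[ℂ] ℂ) (htr : IsTracialStateA tr)
    {n : ℕ} (a : Fin n → 𝒜) (ha : ∀ i, IsSelfAdjoint (a i))
    (τ : NCPoly n →ₗ[ℂ] ℂ) (hlaw : ∀ f : NCPoly n, τ f = tr (polyEvalA a f))
    (d : ℕ) (P : Word n → NCPoly n) (hONB : IsONB τ d P)
    (k : ℕ) (A : Fin n → Matrix (Fin k) (Fin k) ℂ)
    (hA : ∀ i, (A i).IsHermitian) (e : WordLE n d → Matrix (Fin k) (Fin k) ℂ)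
    (he : cstarNormSqLE (matPolyEvalA a e) 1) :
    (cdKernel d P A - (matPolyEvalM A e)ᴴ * matPolyEvalM A e).PosSemidef := by
  obtain ⟨hP, -, ho, -, -⟩ := hONB
  have horth : ∀ v w : WordLE n d,
      tr (star (ev a (P v.1)) * ev a (P w.1)) = if v = w then 1 else 0 := by
    intro v w
    have := ho v.1 w.1 v.2 w.2
    rw [hlaw, polyEvalA_eq, map_mul, ev_ncStar a ha] at this
    rw [this]
    simp only [Subtype.ext_iff]
  choose c hc using expand tr htr a ha d P hP horth
  set b : WordLE n d → Matrix (Fin k) (Fin k) ℂ := fun v => ∑ w, c w v • e w with hb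
  have hM : matPolyEvalM A e = ∑ v : WordLE n d, b v * ev A (ncStar (P v.1)) := by
    have h1 : ∀ w : WordLE n d, wordEvalM A w.1 = ∑ v, c w v • ev A (ncStar (P v.1)) := by
      intro w
      have := congrArg (ev A) (hc w)
      simp only [map_sum, map_smul] at this
      rw [this, mono, MonoidAlgebra.of_apply, ev_single, one_smul]
      rfl
    simp only [matPolyEvalM, h1, hb, Finset.mul_sum, Finset.sum_mul, Matrix.mul_smul,
      Matrix.smul_mul]
    rw [Finset.sum_comm]
  have hR : ∀ i j, matPolyEvalA a e i j = ∑ v : WordLE n d, b v i j • star (ev a (P v.1)) := by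
    have h1 : ∀ w : WordLE n d, wordEvalA a w.1 = ∑ v, c w v • star (ev a (P v.1)) := by
      intro w
      have := congrArg (ev a) (hc w)
      simp only [map_sum, map_smul, ev_ncStar a ha] at this
      rw [this, mono, MonoidAlgebra.of_apply, ev_single, one_smul]
      rfl
    intro i j
    simp only [matPolyEvalA, h1, hb, Matrix.sum_apply, Matrix.map_apply, Matrix.smul_apply,
      Finset.smul_sum, Finset.sum_smul, smul_smul, smul_eq_mul]
    rw [Finset.sum_comm]
    simp only [mul_comm]
  have hG : (matPolyEvalA a e * (matPolyEvalA a e)ᴴ).map tr = ∑ v, b v * (b v)ᴴ := by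
    ext i j
    simp only [Matrix.map_apply, Matrix.mul_apply, Matrix.conjTranspose_apply, hR, star_sum,
      star_smul, star_star, Finset.sum_mul_sum, smul_mul_smul_comm, map_sum, map_smul, horth,
      Matrix.sum_apply, smul_eq_mul, mul_ite, mul_one, mul_zero, Finset.sum_ite_eq,
      Finset.mem_univ, if_true]
    rw [Finset.sum_comm]
  have hpsd : (1 - ∑ v, b v * (b v)ᴴ).PosSemidef := by
    refine Matrix.PosSemidef.of_dotProduct_mulVec_nonneg ?_ ?_
    · refine Matrix.isHermitian_one.sub ?_
      exact (Matrix.posSemidef_sum _ fun v _ =>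
        Matrix.posSemidef_self_mul_conjTranspose (b v)).isHermitian
    · rw [← hG]
      exact idtr_le tr htr _ he
  have hK : cdKernel d P A =
      ∑ v : WordLE n d, (ev A (ncStar (P v.1)))ᴴ * ev A (ncStar (P v.1)) := by
    simp only [cdKernel, polyEvalM_eq]
    refine Finset.sum_congr rfl fun v _ => ?_
    rw [ev_ncStar A hA, Matrix.star_eq_conjTranspose, Matrix.conjTranspose_conjTranspose]
  rw [hM, hK]
  exact kernel_bound b _ hpsd

end
end NCCD
namespace NCCD

/-- If the joint law `τ` of `a` is faithful and `(P_w)` is a family of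
orthonormal polynomials of `τ` at degree `d`, then for every tuple `A` of hermitian `k×k`
matrices: `‖κ_{τ,d}(A,A)(I_k)‖ ≥ Φ^∞_{a,d}(A)` and `tr_k(κ_{τ,d}(A,A)(I_k)) ≥ Φ²_{a,d}(A)`. -/
theorem cdKernel_ge_siciak {𝒜 : Type*} [NormedRing 𝒜] [StarRing 𝒜] [CStarRing 𝒜]
    [CompleteSpace 𝒜] [NormedAlgebra ℂ 𝒜] [StarModule ℂ 𝒜]
    (tr : 𝒜 →ₗ[ℂ] ℂ) (htr : IsTracialStateA tr) (hfaith : IsFaithfulA tr)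
    {n : ℕ} (a : Fin n → 𝒜) (ha : ∀ i, IsSelfAdjoint (a i))
    (τ : NCPoly n →ₗ[ℂ] ℂ) (hlaw : ∀ f : NCPoly n, τ f = tr (polyEvalA a f))
    (hτfaith : IsFaithful τ)
    (d : ℕ) (P : Word n → NCPoly n) (hONB : IsONB τ d P)
    (k : ℕ) (hk : 1 ≤ k) (A : Fin n → Matrix (Fin k) (Fin k) ℂ)
    (hA : ∀ i, (A i).IsHermitian) :
    PhiInf a d k A ≤ ‖cdKernel d P A‖ ∧
    Phi2 a d k A ≤ (Matrix.trace (cdKernel d P A)).re / k := by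
  have hk' := fun e he => key tr htr a ha τ hlaw d P hONB k A hA e he
  have hz : cstarNormSqLE (matPolyEvalA a (0 : WordLE n d → Matrix (Fin k) (Fin k) ℂ)) 1 := by
    refine ⟨1, ?_⟩
    have : matPolyEvalA a (0 : WordLE n d → Matrix (Fin k) (Fin k) ℂ) = 0 := by
      ext i j
      simp [matPolyEvalA, Matrix.sum_apply]
    simp [this]
  constructor
  · refine csSup_le ⟨_, 0, hz, rfl⟩ ?_
    rintro t ⟨e, he, rfl⟩
    exact norm_le_of_psd _ _ (hk' e he)
  · refine csSup_le ⟨_, 0, hz, rfl⟩ ?_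
    rintro t ⟨e, he, rfl⟩
    have h := (hk' e he).trace_nonneg
    rw [Matrix.trace_sub] at h
    have h2 := (Complex.le_def.1 h).1
    simp only [Complex.zero_re, Complex.sub_re] at h2
    exact div_le_div_of_nonneg_right (by linarith) (Nat.cast_nonneg k)

end NCCD
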